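/- Let d ≥ 3 and γ ∈ (0, 1/2), and let Ω ⊆ ℝ^d be a nonempty open set. Let u : ℝ^d → ℝ^d be continuous on Ω with finite γ-Hölder seminorm on Ω and weakly divergence-free on Ω. Let p : ℝ^d → ℝ be continuous on Ω, locally integrable on Ω, and suppose the pair (u, p) satisfies the weak pressure equation on Ω. Then p is locally of double Hölder regularity C^{0,2γ} in Ω: for every compact set K ⊆ Ω there exists a constant C > 0 such that |p(x₁) − p(x₂)| ≤ C ‖x₁ − x₂‖^{2γ} for all x₁, x₂ ∈ K. -/

import Mathlib

open MeasureTheory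
open scoped RealInnerProductSpace

/-- Second-order partial derivative `∂ᵢ∂ⱼ φ` on Euclidean space. -/
noncomputable def pd2 {d : ℕ} (φ : EuclideanSpace ℝ (Fin d) → ℝ) (i j : Fin d)
    (y : EuclideanSpace ℝ (Fin d)) : ℝ :=
  fderiv ℝ (fun z => fderiv ℝ φ z (EuclideanSpace.single i 1)) y (EuclideanSpace.single j 1)

/-- A test function on an open set `Ω`: smooth, compactly supported, support inside `Ω`. -/
def IsTestFun {d : ℕ} (Ω : Set (EuclideanSpace ℝ (Fin d)))
    (φ : EuclideanSpace ℝ (Fin d) → ℝ) : Prop :=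
  ContDiff ℝ (⊤ : ℕ∞) φ ∧ HasCompactSupport φ ∧ tsupport φ ⊆ Ω


section RadialProfile
open Set

/-- Smooth profile `t ^ (-d/2)` cut off near zero. -/
noncomputable def gProf (d : ℕ) (t : ℝ) : ℝ := t ^ (-(d:ℝ)/2) * Real.smoothTransition (4*t-1)

noncomputable def GProf (d : ℕ) (t : ℝ) : ℝ := gProf d t - 2^d * gProf d (4*t)

noncomputable def PhiProf (d : ℕ) (t : ℝ) : ℝ := ∫ τ in (1:ℝ)..t, GProf d τ

noncomputable def EProf (d : ℕ) (t : ℝ) : ℝ := 4 * t * deriv (gProf d) t + 2 * d * gProf d t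

lemma gProf_contDiff (d : ℕ) : ContDiff ℝ (⊤ : ℕ∞) (gProf d) := by
  rw [contDiff_iff_contDiffAt]
  intro t
  rcases lt_or_ge t (1/4) with h | h
  · have : gProf d =ᶠ[nhds t] fun _ => 0 := by
      filter_upwards [Iio_mem_nhds h] with s hs
      simp only [gProf]
      rw [Real.smoothTransition.zero_of_nonpos (by simp only [mem_Iio] at hs; linarith), mul_zero]
    exact contDiffAt_const.congr_of_eventuallyEq this
  · unfold gProf
    refine ContDiffAt.mul (Real.contDiffAt_rpow_const_of_ne (by linarith)) ?_
    exact (Real.smoothTransition.contDiff.comp (by fun_prop : ContDiff ℝ (⊤ : ℕ∞) fun t : ℝ => 4*t-1)).contDiffAt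

lemma gProf_eq {d : ℕ} {t : ℝ} (h : 1/2 ≤ t) : gProf d t = t ^ (-(d:ℝ)/2) := by
  simp only [gProf]
  rw [Real.smoothTransition.one_of_one_le (by linarith), mul_one]

lemma GProf_contDiff (d : ℕ) : ContDiff ℝ (⊤ : ℕ∞) (GProf d) := by
  unfold GProf
  have := gProf_contDiff d
  fun_prop

lemma GProf_zero {d : ℕ} {t : ℝ} (h : 1/2 ≤ t) : GProf d t = 0 := by
  simp only [GProf]
  rw [gProf_eq h, gProf_eq (by linarith), Real.mul_rpow (by norm_num) (by linarith)]
  have : (2:ℝ)^d * (4:ℝ) ^ (-(d:ℝ)/2) = 1 := by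
    rw [show (4:ℝ) = 2 ^ (2:ℝ) by norm_num, ← Real.rpow_mul (by norm_num), ← Real.rpow_natCast,
      ← Real.rpow_add (by norm_num)]
    ring_nf; simp
  rw [← mul_assoc, this, one_mul, sub_self]

lemma PhiProf_hasDerivAt (d : ℕ) (t : ℝ) : HasDerivAt (PhiProf d) (GProf d t) t :=
  intervalIntegral.integral_hasDerivAt_right ((GProf_contDiff d).continuous.intervalIntegrable _ _)
    ((GProf_contDiff d).continuous.stronglyMeasurableAtFilter _ _) (GProf_contDiff d).continuous.continuousAt

lemma PhiProf_contDiff (d : ℕ) : ContDiff ℝ (⊤ : ℕ∞) (PhiProf d) := by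
  rw [contDiff_infty_iff_deriv]
  refine ⟨fun t => (PhiProf_hasDerivAt d t).differentiableAt, ?_⟩
  have : deriv (PhiProf d) = GProf d := funext fun t => (PhiProf_hasDerivAt d t).deriv
  rw [this]; exact GProf_contDiff d

lemma PhiProf_zero {d : ℕ} {t : ℝ} (h : 1 ≤ t) : PhiProf d t = 0 := by
  unfold PhiProf
  rw [intervalIntegral.integral_congr (g := fun _ => 0)]
  · simp
  · intro s hs
    rw [uIcc_of_le h] at hs
    exact GProf_zero (by linarith [hs.1])

lemma gProf_hasDerivAt (d : ℕ) (t : ℝ) : HasDerivAt (gProf d) (deriv (gProf d) t) t :=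
  (((gProf_contDiff d).differentiable (by simp)) t).hasDerivAt

lemma GProf_hasDerivAt (d : ℕ) (t : ℝ) :
    HasDerivAt (GProf d) (deriv (gProf d) t - 2^d * (deriv (gProf d) (4*t) * 4)) t := by
  have h2 : HasDerivAt (fun t : ℝ => 4 * t) 4 t := by simpa using (hasDerivAt_id t).const_mul 4
  have := (gProf_hasDerivAt d (4*t)).comp t h2
  exact (gProf_hasDerivAt d t).sub (this.const_mul _)

lemma prof_identity (d : ℕ) (t : ℝ) :
    4 * t * deriv (GProf d) t + 2 * d * GProf d t = EProf d t - 2^d * EProf d (4*t) := by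
  rw [(GProf_hasDerivAt d t).deriv]
  simp only [EProf, GProf]; ring

lemma EProf_contDiff (d : ℕ) : ContDiff ℝ (⊤ : ℕ∞) (EProf d) := by
  unfold EProf
  have h1 := gProf_contDiff d
  have h2 := (contDiff_infty_iff_deriv.1 h1).2
  fun_prop

lemma EProf_eq {d : ℕ} {t : ℝ} (ht : 0 < t) :
    EProf d t = 16 * t * (t ^ (-(d:ℝ)/2) * deriv Real.smoothTransition (4*t-1)) := by
  have h1 : HasDerivAt (fun t : ℝ => t ^ (-(d:ℝ)/2)) (-(d:ℝ)/2 * t ^ (-(d:ℝ)/2 - 1)) t :=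
    Real.hasDerivAt_rpow_const (Or.inl ht.ne')
  have h2 : HasDerivAt (fun t : ℝ => 4 * t - 1) 4 t := by
    simpa using ((hasDerivAt_id t).const_mul 4).sub_const 1
  have h3 : HasDerivAt Real.smoothTransition (deriv Real.smoothTransition (4*t-1)) (4*t-1) :=
    ((Real.smoothTransition.contDiff (n := 1)).differentiable (by simp) _).hasDerivAt
  have h4 := h1.mul (h3.comp t h2)
  have h5 : deriv (gProf d) t = _ := h4.deriv
  simp only [EProf]
  rw [h5]
  simp only [gProf, Function.comp]
  rw [Real.rpow_sub_one ht.ne']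
  field_simp
  ring

lemma EProf_nonneg {d : ℕ} {t : ℝ} (ht : 0 ≤ t) : 0 ≤ EProf d t := by
  rcases ht.eq_or_lt with rfl | ht
  · simp only [EProf, gProf]
    rw [Real.smoothTransition.zero_of_nonpos (by norm_num)]; simp
  · rw [EProf_eq ht]
    have : 0 ≤ deriv Real.smoothTransition (4*t-1) :=
      (Real.smoothTransition.monotone).deriv_nonneg
    positivity

lemma EProf_zero {d : ℕ} {t : ℝ} (h : 1 ≤ t) : EProf d t = 0 := by
  rw [EProf_eq (by linarith)]
  have : Real.smoothTransition =ᶠ[nhds (4*t-1)] fun _ => 1 := by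
    filter_upwards [Ioi_mem_nhds (show (1:ℝ) < 4*t-1 by linarith)] with s hs
    exact Real.smoothTransition.one_of_one_le (le_of_lt hs)
  rw [this.deriv_eq]; simp

lemma EProf_exists_ne (d : ℕ) : ∃ t > 0, EProf d t ≠ 0 := by
  obtain ⟨c, hc, hc'⟩ := exists_deriv_eq_slope Real.smoothTransition (show (0:ℝ) < 1 by norm_num)
    Real.smoothTransition.continuous.continuousOn
    ((Real.smoothTransition.contDiff (n := 1)).differentiable (by simp)).differentiableOn
  have h0 : (0:ℝ) < (c+1)/4 := by linarith [hc.1]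
  refine ⟨(c+1)/4, h0, ?_⟩
  rw [EProf_eq h0]
  rw [show 4 * ((c+1)/4) - 1 = c by ring, hc', Real.smoothTransition.one_of_one_le le_rfl,
    Real.smoothTransition.zero_of_nonpos le_rfl]
  have := Real.rpow_pos_of_pos h0 (-(d:ℝ)/2)
  positivity

end RadialProfile

section WeakForm
open Set

variable {d : ℕ}

lemma IsTestFun.dirDeriv {Ω : Set (EuclideanSpace ℝ (Fin d))} {φ : EuclideanSpace ℝ (Fin d) → ℝ}
    (h : IsTestFun Ω φ) (v : EuclideanSpace ℝ (Fin d)) :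
    IsTestFun Ω (fun z => fderiv ℝ φ z v) := by
  obtain ⟨h1, h2, h3⟩ := h
  have hs : tsupport (fun z => fderiv ℝ φ z v) ⊆ tsupport φ := tsupport_fderiv_apply_subset ℝ v
  refine ⟨?_, h2.fderiv_apply ℝ v, hs.trans h3⟩
  have : ContDiff ℝ (⊤ : ℕ∞) (fderiv ℝ φ) := h1.fderiv_right (by simp)
  fun_prop

lemma IsTestFun.pd2_test {Ω : Set (EuclideanSpace ℝ (Fin d))} {φ : EuclideanSpace ℝ (Fin d) → ℝ}
    (h : IsTestFun Ω φ) (i j : Fin d) : IsTestFun Ω (pd2 φ i j) :=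
  (h.dirDeriv (EuclideanSpace.single i 1)).dirDeriv (EuclideanSpace.single j 1)

lemma pd2_symm {φ : EuclideanSpace ℝ (Fin d) → ℝ} (h : ContDiff ℝ (⊤ : ℕ∞) φ) (i j : Fin d)
    (y : EuclideanSpace ℝ (Fin d)) : pd2 φ i j y = pd2 φ j i y := by
  have h1 : ContDiff ℝ (⊤ : ℕ∞) (fderiv ℝ φ) := h.fderiv_right (by simp)
  have h2 : ∀ v w, fderiv ℝ (fun z => fderiv ℝ φ z v) y w = fderiv ℝ (fderiv ℝ φ) y w v := by
    intro v w
    rw [fderiv_clm_apply (h1.differentiable (by simp) y) (by fun_prop)]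
    simp
  have hs : IsSymmSndFDerivAt ℝ φ y := h.contDiffAt.isSymmSndFDerivAt (by simp only [minSmoothness_of_isRCLikeNormedField]; exact WithTop.coe_le_coe.2 le_top)
  unfold pd2
  rw [h2, h2]
  exact hs.eq _ _

lemma integrableOn_mul_test {Ω : Set (EuclideanSpace ℝ (Fin d))} (hΩ : IsOpen Ω)
    {f g : EuclideanSpace ℝ (Fin d) → ℝ} (hf : ContinuousOn f Ω) (hg : Continuous g)
    (hc : HasCompactSupport g) (hs : tsupport g ⊆ Ω) :
    IntegrableOn (fun y => f y * g y) Ω := by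
  have h1 : IntegrableOn (fun y => f y * g y) (tsupport g) :=
    ((hf.mono hs).mul hg.continuousOn).integrableOn_compact hc
  refine h1.of_forall_sdiff_eq_zero hΩ.measurableSet ?_
  intro x hx
  rw [image_eq_zero_of_notMem_tsupport hx.2, mul_zero]

lemma integral_fderiv_test {Ω : Set (EuclideanSpace ℝ (Fin d))}
    {φ : EuclideanSpace ℝ (Fin d) → ℝ}
    (h : IsTestFun Ω φ) (v : EuclideanSpace ℝ (Fin d)) :
    ∫ y in Ω, fderiv ℝ φ y v = 0 := by
  have hp := h.dirDeriv v
  rw [setIntegral_eq_integral_of_forall_compl_eq_zero]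
  · have := integral_mul_fderiv_eq_neg_fderiv_mul_of_integrable (μ := (volume : Measure (EuclideanSpace ℝ (Fin d))))
      (f := fun _ => (1:ℝ)) (g := φ) (v := v) (by simp)
      (by simpa using hp.1.continuous.integrable_of_hasCompactSupport hp.2.1)
      (by simpa using h.1.continuous.integrable_of_hasCompactSupport h.2.1)
      (by fun_prop) (fun x _ => h.1.differentiable (by simp) x)
    simpa using this
  · intro y hy
    exact image_eq_zero_of_notMem_tsupport (f := fun z => fderiv ℝ φ z v) (fun hh => hy (hp.2.2 hh))

lemma sub_const_identity {Ω : Set (EuclideanSpace ℝ (Fin d))} (hΩ : IsOpen Ω)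
    {u : EuclideanSpace ℝ (Fin d) → EuclideanSpace ℝ (Fin d)} (hu : ContinuousOn u Ω)
    (hdiv : ∀ φ : EuclideanSpace ℝ (Fin d) → ℝ, IsTestFun Ω φ →
      ∫ y in Ω, ⟪u y, gradient φ y⟫ = 0)
    (c : EuclideanSpace ℝ (Fin d)) {φ : EuclideanSpace ℝ (Fin d) → ℝ} (hφ : IsTestFun Ω φ) :
    ∫ y in Ω, (∑ i, ∑ j, u y i * u y j * pd2 φ i j y) =
      ∫ y in Ω, (∑ i, ∑ j, (u y i - c i) * (u y j - c j) * pd2 φ i j y) := by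
  have hui : ∀ i, ContinuousOn (fun y => u y i) Ω := fun i =>
    (EuclideanSpace.proj (𝕜 := ℝ) i).continuous.comp_continuousOn hu
  have hint : ∀ (f : EuclideanSpace ℝ (Fin d) → ℝ) (i j : Fin d), ContinuousOn f Ω →
      IntegrableOn (fun y => f y * pd2 φ i j y) Ω := fun f i j hf =>
    integrableOn_mul_test hΩ hf (hφ.pd2_test i j).1.continuous (hφ.pd2_test i j).2.1
      (hφ.pd2_test i j).2.2
  have hA : ∀ i, ∀ y, ⟪u y, gradient (fun z => fderiv ℝ φ z (EuclideanSpace.single i 1)) y⟫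
      = ∑ j, u y j * pd2 φ i j y := by
    intro i y
    rw [inner_gradient_right]
    have : u y = ∑ j, u y j • EuclideanSpace.single j (1:ℝ) := by
      ext k; simp [Pi.single_apply]
    conv_lhs => rw [this]
    simp [pd2]
  have hB : ∀ i, ∫ y in Ω, ∑ j, u y j * pd2 φ i j y = 0 := by
    intro i
    rw [← hdiv _ (hφ.dirDeriv (EuclideanSpace.single i 1))]
    simp only [hA]
  have hBi : ∀ i, IntegrableOn (fun y => ∑ j, u y j * pd2 φ i j y) Ω := fun i =>
    integrable_finsetSum _ fun j _ => hint _ i j (hui j)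
  have hD : ∀ i j, ∫ y in Ω, pd2 φ i j y = 0 := fun i j =>
    integral_fderiv_test (hφ.dirDeriv (EuclideanSpace.single i 1)) _
  have hDi : ∀ i j, IntegrableOn (fun y => c i * c j * pd2 φ i j y) Ω := fun i j =>
    hint _ i j continuousOn_const
  have hpt : ∀ y, (∑ i, ∑ j, (u y i - c i) * (u y j - c j) * pd2 φ i j y) =
      (∑ i, ∑ j, u y i * u y j * pd2 φ i j y) - (∑ i, (2 * c i) * ∑ j, u y j * pd2 φ i j y)
       + ∑ i, ∑ j, c i * c j * pd2 φ i j y := by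
    intro y
    have e1 : ∑ i, ∑ j, c j * u y i * pd2 φ i j y = ∑ i, ∑ j, c i * u y j * pd2 φ i j y := by
      rw [Finset.sum_comm]
      refine Finset.sum_congr rfl fun i _ => Finset.sum_congr rfl fun j _ => ?_
      rw [pd2_symm hφ.1 j i y]
    have e2 : ∑ i, (2 * c i) * ∑ j, u y j * pd2 φ i j y =
      ∑ i, ∑ j, c i * u y j * pd2 φ i j y + ∑ i, ∑ j, c j * u y i * pd2 φ i j y := by
      rw [e1, ← Finset.sum_add_distrib]
      refine Finset.sum_congr rfl fun i _ => ?_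
      rw [Finset.mul_sum, ← Finset.sum_add_distrib]
      refine Finset.sum_congr rfl fun j _ => ?_
      ring
    rw [e2]
    simp only [← Finset.sum_add_distrib, ← Finset.sum_sub_distrib]
    refine Finset.sum_congr rfl fun i _ => Finset.sum_congr rfl fun j _ => ?_
    ring
  simp_rw [hpt]
  have i1 : IntegrableOn (fun y => ∑ i, ∑ j, u y i * u y j * pd2 φ i j y) Ω :=
    integrable_finsetSum _ fun i _ => integrable_finsetSum _ fun j _ =>
      hint _ i j ((hui i).mul (hui j))
  have i2 : IntegrableOn (fun y => ∑ i, (2 * c i) * ∑ j, u y j * pd2 φ i j y) Ω :=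
    integrable_finsetSum _ fun i _ => (hBi i).const_mul _
  have i3 : IntegrableOn (fun y => ∑ i, ∑ j, c i * c j * pd2 φ i j y) Ω :=
    integrable_finsetSum _ fun i _ => integrable_finsetSum _ fun j _ => hDi i j
  rw [integral_add (by exact i1.sub i2) i3, integral_sub i1 i2]
  rw [integral_finsetSum _ fun i _ => (hBi i).const_mul _]
  rw [integral_finsetSum _ fun i _ => integrable_finsetSum _ fun j _ => hDi i j]
  simp_rw [integral_finsetSum _ fun j _ => hDi _ j, integral_const_mul, hB, hD]
  simp

end WeakForm

section Kernel
open Set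

variable {d : ℕ}

noncomputable def phi0 (d : ℕ) (z : EuclideanSpace ℝ (Fin d)) : ℝ := PhiProf d (‖z‖^2)

noncomputable def eta0 (d : ℕ) (z : EuclideanSpace ℝ (Fin d)) : ℝ := EProf d (‖z‖^2)

lemma phi0_contDiff (d : ℕ) : ContDiff ℝ (⊤ : ℕ∞) (phi0 d) :=
  (PhiProf_contDiff d).comp (contDiff_norm_sq ℝ)

lemma eta0_contDiff (d : ℕ) : ContDiff ℝ (⊤ : ℕ∞) (eta0 d) :=
  (EProf_contDiff d).comp (contDiff_norm_sq ℝ)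

lemma phi0_zero {z : EuclideanSpace ℝ (Fin d)} (h : 1 ≤ ‖z‖) : phi0 d z = 0 :=
  PhiProf_zero (one_le_pow₀ h)

lemma eta0_zero {z : EuclideanSpace ℝ (Fin d)} (h : 1 ≤ ‖z‖) : eta0 d z = 0 :=
  EProf_zero (one_le_pow₀ h)

lemma fderiv_phi0 (z v : EuclideanSpace ℝ (Fin d)) :
    fderiv ℝ (phi0 d) z v = GProf d (‖z‖^2) * (2 * ⟪z, v⟫) := by
  have h1 : HasFDerivAt (fun z : EuclideanSpace ℝ (Fin d) => ‖z‖^2) _ z :=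
    (hasStrictFDerivAt_norm_sq z).hasFDerivAt
  have h2 := (PhiProf_hasDerivAt d (‖z‖^2)).comp_hasFDerivAt z h1
  have h3 : HasFDerivAt (phi0 d) _ z := h2
  rw [h3.fderiv]
  simp

lemma pd2_phi0_diag (i : Fin d) (z : EuclideanSpace ℝ (Fin d)) :
    pd2 (phi0 d) i i z = 4 * (z i)^2 * deriv (GProf d) (‖z‖^2) + 2 * GProf d (‖z‖^2) := by
  unfold pd2
  simp_rw [fderiv_phi0]
  have h1 : HasFDerivAt (fun z : EuclideanSpace ℝ (Fin d) => ‖z‖^2) _ z :=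
    (hasStrictFDerivAt_norm_sq z).hasFDerivAt
  have h2 := (GProf_hasDerivAt d (‖z‖^2)).differentiableAt.hasDerivAt.comp_hasFDerivAt z h1
  have h3 : HasFDerivAt (fun z : EuclideanSpace ℝ (Fin d) =>
      2 * ⟪z, EuclideanSpace.single i (1:ℝ)⟫) ((2:ℝ) • innerSL ℝ (EuclideanSpace.single i (1:ℝ))) z := by
    have h := ((innerSL ℝ (EuclideanSpace.single i (1:ℝ) : EuclideanSpace ℝ (Fin d))).hasFDerivAt
      (x := z)).const_mul (2:ℝ)
    have e : (fun z : EuclideanSpace ℝ (Fin d) => 2 * ⟪z, EuclideanSpace.single i (1:ℝ)⟫) =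
        fun y => 2 * (innerSL ℝ (EuclideanSpace.single i (1:ℝ))) y := by
      ext y; rw [innerSL_apply_apply, real_inner_comm]
    rw [e]; exact h
  have h4 := (h2.mul h3).fderiv
  simp only [Function.comp_def] at h4
  rw [show (fun z : EuclideanSpace ℝ (Fin d) => GProf d (‖z‖ ^ 2) *
    (2 * ⟪z, EuclideanSpace.single i (1:ℝ)⟫)) = (fun z => GProf d (‖z‖ ^ 2)) * (fun z =>
    (2 * ⟪z, EuclideanSpace.single i (1:ℝ)⟫)) from rfl, h4]
  simp [EuclideanSpace.inner_single_right]
  ring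

lemma lap_phi0 (z : EuclideanSpace ℝ (Fin d)) :
    ∑ i, pd2 (phi0 d) i i z = eta0 d z - 2^d * eta0 d ((2:ℝ) • z) := by
  simp_rw [pd2_phi0_diag]
  rw [Finset.sum_add_distrib, ← Finset.sum_mul, ← Finset.mul_sum, ← EuclideanSpace.real_norm_sq_eq]
  have := prof_identity d (‖z‖^2)
  simp only [eta0, norm_smul, mul_pow]
  norm_num
  rw [← this]; ring

lemma fderiv_scale {φ : EuclideanSpace ℝ (Fin d) → ℝ} (hφ : Differentiable ℝ φ) (s : ℝ)
    (x y v : EuclideanSpace ℝ (Fin d)) :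
    fderiv ℝ (fun y => φ (s • (y - x))) y v = s * fderiv ℝ φ (s • (y - x)) v := by
  have h1 : HasFDerivAt (fun y : EuclideanSpace ℝ (Fin d) => s • (y - x))
      (s • ContinuousLinearMap.id ℝ (EuclideanSpace ℝ (Fin d))) y :=
    ((hasFDerivAt_id y).sub_const x).const_smul s
  have h2 := (hφ (s • (y - x))).hasFDerivAt.comp y h1
  have h3 : HasFDerivAt (fun y => φ (s • (y - x))) _ y := h2
  rw [h3.fderiv]
  simp

lemma pd2_scale {φ : EuclideanSpace ℝ (Fin d) → ℝ} (hφ : ContDiff ℝ (⊤ : ℕ∞) φ) (s : ℝ)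
    (x y : EuclideanSpace ℝ (Fin d)) (i j : Fin d) :
    pd2 (fun y => φ (s • (y - x))) i j y = s^2 * pd2 φ i j (s • (y - x)) := by
  unfold pd2
  have h1 : ContDiff ℝ (⊤ : ℕ∞) (fderiv ℝ φ) := hφ.fderiv_right (by simp)
  simp_rw [fderiv_scale (hφ.differentiable (by simp))]
  have h2 : ContDiff ℝ (⊤ : ℕ∞) (fun z => fderiv ℝ φ z (EuclideanSpace.single i 1)) := by fun_prop
  have h3 : Differentiable ℝ (fun z => fderiv ℝ φ z (EuclideanSpace.single i 1)) :=
    h2.differentiable (by simp)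
  rw [fderiv_const_mul (by
    exact (h3.comp (by fun_prop : Differentiable ℝ
      fun y : EuclideanSpace ℝ (Fin d) => s • (y - x))) y)]
  have h4 := fderiv_scale h3 s x y (EuclideanSpace.single j 1)
  simp only [FunLike.coe_smul, Pi.smul_apply, smul_eq_mul]
  rw [h4]; ring

/-- a smooth function vanishing off the unit ball, rescaled, is a test function -/
lemma scaled_test {Ω : Set (EuclideanSpace ℝ (Fin d))} {φ : EuclideanSpace ℝ (Fin d) → ℝ}
    (hφ : ContDiff ℝ (⊤ : ℕ∞) φ) (h0 : ∀ z, 1 ≤ ‖z‖ → φ z = 0)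
    {s : ℝ} (hs : 0 < s) {x : EuclideanSpace ℝ (Fin d)} (hx : Metric.closedBall x s ⊆ Ω) :
    IsTestFun Ω (fun y => φ (s⁻¹ • (y - x))) := by
  have h1 : tsupport (fun y => φ (s⁻¹ • (y - x))) ⊆ Metric.closedBall x s := by
    refine closure_minimal ?_ Metric.isClosed_closedBall
    intro y hy
    by_contra hn
    apply hy
    apply h0
    rw [norm_smul, norm_inv, Real.norm_of_nonneg hs.le, ← dist_eq_norm]
    rw [Metric.mem_closedBall, not_le] at hn
    rw [inv_mul_eq_div, one_le_div hs]; exact hn.le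
  refine ⟨by fun_prop, ?_, h1.trans hx⟩
  exact (isCompact_closedBall x s).of_isClosed_subset (isClosed_tsupport _) h1

lemma unit_test {φ : EuclideanSpace ℝ (Fin d) → ℝ}
    (hφ : ContDiff ℝ (⊤ : ℕ∞) φ) (h0 : ∀ z, 1 ≤ ‖z‖ → φ z = 0) :
    IsTestFun (Metric.closedBall 0 1) φ := by
  simpa using scaled_test (s := 1) (x := 0) hφ h0 one_pos subset_rfl

lemma IsTestFun.bounds {Ω : Set (EuclideanSpace ℝ (Fin d))} {φ : EuclideanSpace ℝ (Fin d) → ℝ}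
    (h : IsTestFun Ω φ) :
    ∃ M : ℝ, 0 ≤ M ∧ (∀ z, |φ z| ≤ M) ∧ ∀ z w, |φ z - φ w| ≤ M * ‖z - w‖ := by
  obtain ⟨C, hC⟩ := h.2.1.exists_bound_of_continuous h.1.continuous
  obtain ⟨L, hL⟩ := h.1.lipschitzWith_of_hasCompactSupport h.2.1 (by simp)
  refine ⟨max C L, le_max_of_le_right L.2, fun z => (hC z).trans (le_max_left _ _), fun z w => ?_⟩
  have := hL.dist_le_mul z w
  rw [dist_eq_norm, dist_eq_norm, Real.norm_eq_abs] at this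
  exact this.trans (by gcongr; exact le_max_right _ _)

lemma eta0_integral_pos (hd : 0 < d) : 0 < ∫ z, eta0 d z := by
  obtain ⟨t, ht, hE⟩ := EProf_exists_ne d
  have hT := unit_test (eta0_contDiff d) (fun z => eta0_zero)
  refine (eta0_contDiff d).continuous.integral_pos_of_hasCompactSupport_nonneg_nonzero
    (x := EuclideanSpace.single ⟨0, hd⟩ (Real.sqrt t)) hT.2.1 (fun z => EProf_nonneg (by positivity)) ?_
  simp only [eta0, PiLp.norm_single, Real.norm_eq_abs, sq_abs]
  rwa [Real.sq_sqrt ht.le]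

end Kernel

section Scales
open Set Filter Topology

lemma single_scale_bound {a R A P : ℝ} {Q : ℝ → ℝ} (ha : 0 < a) (hA : 0 ≤ A)
    (h : ∀ s, 0 < s → s ≤ R → |Q s - Q (s/2)| ≤ A * s^a)
    (hlim : Tendsto Q (𝓝[>] 0) (𝓝 P)) {s : ℝ} (hs : 0 < s) (hsR : s ≤ R) :
    |Q s - P| ≤ A / (1 - 2^(-a)) * s^a := by
  have hq : (2:ℝ)^(-a) < 1 := Real.rpow_lt_one_of_one_lt_of_neg (by norm_num) (by linarith)
  set q : ℝ := (2:ℝ)^(-a) with hqdef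
  have hκ : 0 ≤ A / (1 - q) := div_nonneg hA (by linarith)
  have hn : ∀ n : ℕ, |Q s - Q (s/2^n)| ≤ A / (1-q) * (s^a - (s/2^n)^a) := by
    intro n
    induction n with
    | zero => simp
    | succ n ih =>
      have hp : 0 < s / 2^n := by positivity
      have hle : s / 2^n ≤ R := (div_le_self hs.le (one_le_pow₀ (by norm_num))).trans hsR
      have h1 := h (s/2^n) hp hle
      have e : s / 2^(n+1) = s/2^n/2 := by rw [pow_succ]; field_simp
      have e2 : (s / 2^n/2)^a = q * (s/2^n)^a := by
        rw [Real.div_rpow hp.le (by norm_num), hqdef, Real.rpow_neg (by norm_num)]; field_simp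
      rw [e, e2]
      have h3 : A * (s/2^n)^a = A/(1-q) * ((s/2^n)^a - q * (s/2^n)^a) := by
        have : 1 - q ≠ 0 := by linarith
        field_simp
      calc |Q s - Q (s/2^n/2)| ≤ |Q s - Q (s/2^n)| + |Q (s/2^n) - Q (s/2^n/2)| :=
            abs_sub_le _ _ _
        _ ≤ A / (1-q) * (s^a - (s/2^n)^a) + A/(1-q) * ((s/2^n)^a - q * (s/2^n)^a) := by
            rw [← h3]; exact add_le_add ih h1
        _ = _ := by ring
  have ht : Tendsto (fun n : ℕ => s / 2^n) atTop (𝓝[>] 0) := by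
    refine tendsto_nhdsWithin_iff.2 ⟨?_, Eventually.of_forall fun n => by
      simp only [mem_Ioi]; positivity⟩
    have := (tendsto_pow_atTop_nhds_zero_of_lt_one (r := (1/2:ℝ)) (by norm_num) (by norm_num)).const_mul s
    simpa [div_eq_mul_inv] using this
  have ht2 : Tendsto (fun n : ℕ => |Q s - Q (s/2^n)|) atTop (𝓝 |Q s - P|) :=
    (tendsto_const_nhds.sub (hlim.comp ht)).abs
  refine le_of_tendsto ht2 (Eventually.of_forall fun n => (hn n).trans ?_)
  have : 0 ≤ (s/2^n)^a := by positivity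
  gcongr; linarith

lemma two_point_scales {a R A B L r P1 P2 : ℝ} {Q1 Q2 : ℝ → ℝ} (ha : 0 < a) (ha1 : a < 1)
    (hA : 0 ≤ A) (hB : 0 ≤ B) (hL : 0 ≤ L) (hr : 0 < r) (hrR : r ≤ R)
    (h1 : ∀ s, 0 < s → s ≤ R → |Q1 s - Q1 (s/2)| ≤ A * s^a)
    (h2 : ∀ s, 0 < s → s ≤ R → |Q2 s - Q2 (s/2)| ≤ A * s^a)
    (h12 : ∀ s, r ≤ s → s ≤ R → |(Q1 s - Q1 (s/2)) - (Q2 s - Q2 (s/2))| ≤ B * s^(a-1) * r)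
    (hR : |Q1 R - Q2 R| ≤ L * r)
    (hl1 : Tendsto Q1 (𝓝[>] 0) (𝓝 P1)) (hl2 : Tendsto Q2 (𝓝[>] 0) (𝓝 P2)) :
    |P1 - P2| ≤ (2 * (A / (1 - 2^(-a)) * 2^a) + L * R^(1-a) + B / (2^(1-a) - 1)) * r^a := by
  have hR0 : 0 < R := hr.trans_le hrR
  have hq : 1 < (2:ℝ)^(1-a) := Real.one_lt_rpow (by norm_num) (by linarith)
  set q : ℝ := (2:ℝ)^(1-a) with hqdef
  have hB' : 0 ≤ B / (q-1) := div_nonneg hB (by linarith)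
  have hA' : 0 ≤ A / (1 - 2^(-a)) := div_nonneg hA (by
    linarith [Real.rpow_lt_one_of_one_lt_of_neg (x := 2) (z := -a) (by norm_num) (by linarith)])
  have hn : ∀ n : ℕ, r ≤ R/2^n → |Q1 (R/2^n) - Q2 (R/2^n)| ≤
      L * r + B / (q-1) * (R/2^n)^(a-1) * r := by
    intro n
    induction n with
    | zero =>
      intro _
      simp only [pow_zero, div_one]
      have : 0 ≤ B / (q-1) * R^(a-1) * r := by positivity
      linarith
    | succ n ih =>
      intro hrn
      have e : R / 2^(n+1) = R/2^n/2 := by rw [pow_succ]; field_simp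
      rw [e] at hrn ⊢
      have hp : 0 < R / 2^n := by positivity
      have hle : R / 2^n ≤ R := div_le_self hR0.le (one_le_pow₀ (by norm_num))
      have hrn' : r ≤ R / 2^n := by linarith
      have h3 := h12 (R/2^n) hrn' hle
      have ih := ih hrn'
      have e2 : (R / 2^n/2)^(a-1) = q * (R/2^n)^(a-1) := by
        rw [Real.div_rpow hp.le (by norm_num), hqdef, show 1 - a = -(a-1) by ring,
          Real.rpow_neg (by norm_num)]; field_simp
      rw [e2]
      have e3 : B * (R/2^n)^(a-1) * r = B/(q-1) * (q * (R/2^n)^(a-1)) * r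
          - B/(q-1) * (R/2^n)^(a-1) * r := by
        have : q - 1 ≠ 0 := by linarith
        field_simp
      rw [e3] at h3
      have := abs_le.1 h3
      have := abs_le.1 ih
      rw [abs_le]
      constructor <;> linarith
  obtain ⟨n, hn1, hn2⟩ := exists_nat_pow_near_of_lt_one (x := r / R) (y := (1/2:ℝ))
    (by positivity) ((div_le_one hR0).2 hrR) (by norm_num) (by norm_num)
  have hsr : r ≤ R / 2^n := by
    rw [div_le_iff₀ hR0] at hn2
    simpa [div_eq_mul_inv, mul_comm] using hn2
  have hsr2 : R / 2^n ≤ 2 * r := by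
    rw [lt_div_iff₀ hR0, pow_succ] at hn1
    have : R / 2^n = 2 * ((1/2)^n * (1/2) * R) := by
      rw [one_div, inv_pow]; field_simp
    rw [this]; linarith
  set s := R / 2^n with hs
  have hs0 : 0 < s := by positivity
  have hsR : s ≤ R := div_le_self hR0.le (one_le_pow₀ (by norm_num))
  have b1 := single_scale_bound ha hA h1 hl1 hs0 hsR
  have b2 := single_scale_bound ha hA h2 hl2 hs0 hsR
  have b3 := hn n hsr
  have c1 : s^a ≤ 2^a * r^a := by
    rw [← Real.mul_rpow (by norm_num) hr.le]
    exact Real.rpow_le_rpow hs0.le hsr2 ha.le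
  have c2 : s^(a-1) * r ≤ r^a := by
    have : s^(a-1) ≤ r^(a-1) := Real.rpow_le_rpow_of_nonpos hr hsr (by linarith)
    calc s^(a-1) * r ≤ r^(a-1) * r := by gcongr
      _ = r^a := by rw [Real.rpow_sub_one hr.ne']; field_simp
  have c3 : r ≤ R^(1-a) * r^a := by
    calc r = r^(1-a) * r^a := by rw [← Real.rpow_add hr]; simp
      _ ≤ R^(1-a) * r^a := by gcongr
  have d1 : A / (1 - 2^(-a)) * s^a ≤ A / (1 - 2^(-a)) * (2^a * r^a) := by gcongr
  have d2 : B/(q-1) * s^(a-1) * r ≤ B/(q-1) * r^a := by rw [mul_assoc]; gcongr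
  have d3 : L * r ≤ L * (R^(1-a) * r^a) := by gcongr
  have := abs_le.1 b1
  have := abs_le.1 b2
  have := abs_le.1 b3
  rw [abs_le]
  constructor <;> linarith

end Scales

section Averages
open Set Filter Topology

variable {d : ℕ}

lemma setIntegral_ball_bound {Ω : Set (EuclideanSpace ℝ (Fin d))}
    {f : EuclideanSpace ℝ (Fin d) → ℝ} {x : EuclideanSpace ℝ (Fin d)} {ρ m : ℝ} (hρ : 0 ≤ ρ)
    (hx : Metric.closedBall x ρ ⊆ Ω) (hΩ : IsOpen Ω)
    (hf : ∀ y ∈ Metric.closedBall x ρ, |f y| ≤ m) (h0 : ∀ y ∉ Metric.closedBall x ρ, f y = 0) :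
    |∫ y in Ω, f y| ≤
      m * (ρ^d * volume.real (Metric.closedBall (0 : EuclideanSpace ℝ (Fin d)) 1)) := by
  have h1 : ∫ y in Ω, f y = ∫ y in Metric.closedBall x ρ, f y :=
    setIntegral_eq_of_subset_of_forall_sdiff_eq_zero hΩ.measurableSet hx (fun y hy => h0 y hy.2)
  have h2 : volume.real (Metric.closedBall x ρ) =
      ρ^d * volume.real (Metric.closedBall (0 : EuclideanSpace ℝ (Fin d)) 1) := by
    rw [Measure.real, Measure.addHaar_closedBall' _ _ hρ, ENNReal.toReal_mul,
      ENNReal.toReal_ofReal (by positivity)]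
    simp [Measure.real]
  rw [h1, ← h2, ← Real.norm_eq_abs]
  exact norm_setIntegral_le_of_norm_le_const measure_closedBall_lt_top hf

lemma quad_bound {Ω : Set (EuclideanSpace ℝ (Fin d))} (hΩ : IsOpen Ω)
    {u : EuclideanSpace ℝ (Fin d) → EuclideanSpace ℝ (Fin d)} {H γ : ℝ} (hγ : 0 < γ) (hH : 0 ≤ H)
    (hHolder : ∀ x ∈ Ω, ∀ y ∈ Ω, ‖u x - u y‖ ≤ H * ‖x - y‖ ^ γ)
    {k : Fin d → Fin d → EuclideanSpace ℝ (Fin d) → ℝ} {x : EuclideanSpace ℝ (Fin d)} {ρ m : ℝ}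
    (hρ : 0 ≤ ρ) (hx : Metric.closedBall x ρ ⊆ Ω) (hm : 0 ≤ m)
    (hk : ∀ i j y, |k i j y| ≤ m) (h0 : ∀ i j, ∀ y ∉ Metric.closedBall x ρ, k i j y = 0) :
    |∫ y in Ω, ∑ i, ∑ j, (u y i - u x i) * (u y j - u x j) * k i j y| ≤
      (d^2 * (H^2 * ρ^(2*γ) * m)) *
      (ρ^d * volume.real (Metric.closedBall (0 : EuclideanSpace ℝ (Fin d)) 1)) := by
  refine setIntegral_ball_bound hρ hx hΩ ?_ ?_
  · intro y hy
    have h1 : ‖u y - u x‖ ≤ H * ρ^γ := by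
      refine (hHolder y (hx hy) x (hx (Metric.mem_closedBall_self hρ))).trans ?_
      rw [Metric.mem_closedBall, dist_eq_norm] at hy
      gcongr
    have h2 : ∀ i, |u y i - u x i| ≤ H * ρ^γ := fun i =>
      le_trans (by simpa using PiLp.norm_apply_le (u y - u x) i) h1
    have h3 : ∀ i j, |(u y i - u x i) * (u y j - u x j) * k i j y| ≤ H^2 * ρ^(2*γ) * m := by
      intro i j
      rw [abs_mul, abs_mul]
      have : H^2 * ρ^(2*γ) = (H*ρ^γ) * (H * ρ^γ) := by
        rw [two_mul, Real.rpow_add_of_nonneg hρ hγ.le hγ.le]; ring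
      rw [this]
      have := h2 i
      have := h2 j
      have := hk i j y
      gcongr
    calc |∑ i, ∑ j, (u y i - u x i) * (u y j - u x j) * k i j y|
        ≤ ∑ i : Fin d, ∑ j : Fin d, H^2 * ρ^(2*γ) * m :=
          (Finset.abs_sum_le_sum_abs _ _).trans (Finset.sum_le_sum fun i _ =>
            (Finset.abs_sum_le_sum_abs _ _).trans (Finset.sum_le_sum fun j _ => h3 i j))
      _ = _ := by simp; ring
  · intro y hy
    exact Finset.sum_eq_zero fun i _ => Finset.sum_eq_zero fun j _ => by rw [h0 i j y hy, mul_zero]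

/-- average of the pressure at scale `s` -/
noncomputable def Qav (Ω : Set (EuclideanSpace ℝ (Fin d))) (p : EuclideanSpace ℝ (Fin d) → ℝ)
    (x : EuclideanSpace ℝ (Fin d)) (s : ℝ) : ℝ :=
  (s^d)⁻¹ * ∫ y in Ω, p y * eta0 d (s⁻¹ • (y - x))

/-- difference of two consecutive averages -/
noncomputable def Dav (Ω : Set (EuclideanSpace ℝ (Fin d)))
    (u : EuclideanSpace ℝ (Fin d) → EuclideanSpace ℝ (Fin d))
    (c : EuclideanSpace ℝ (Fin d)) (x : EuclideanSpace ℝ (Fin d)) (s : ℝ) : ℝ :=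
  ∫ y in Ω, ∑ i, ∑ j, (u y i - c i) * (u y j - c j) * pd2 (phi0 d) i j (s⁻¹ • (y - x))

lemma Qav_step {Ω : Set (EuclideanSpace ℝ (Fin d))} (hΩ : IsOpen Ω)
    {u : EuclideanSpace ℝ (Fin d) → EuclideanSpace ℝ (Fin d)} (hu : ContinuousOn u Ω)
    {p : EuclideanSpace ℝ (Fin d) → ℝ} (hp : ContinuousOn p Ω)
    (hdiv : ∀ φ : EuclideanSpace ℝ (Fin d) → ℝ, IsTestFun Ω φ →
      ∫ y in Ω, ⟪u y, gradient φ y⟫ = 0)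
    (hpress : ∀ φ : EuclideanSpace ℝ (Fin d) → ℝ, IsTestFun Ω φ →
      ∫ y in Ω, p y * (∑ i, pd2 φ i i y) =
        - ∫ y in Ω, (∑ i, ∑ j, u y i * u y j * pd2 φ i j y))
    {x : EuclideanSpace ℝ (Fin d)} {s : ℝ} (hs : 0 < s) (hx : Metric.closedBall x s ⊆ Ω)
    (c : EuclideanSpace ℝ (Fin d)) :
    Qav Ω p x s - Qav Ω p x (s/2) = - ((s^d)⁻¹ * Dav Ω u c x s) := by
  have hT := scaled_test (phi0_contDiff d) (fun z => phi0_zero) hs hx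
  have h1 := hpress _ hT
  rw [sub_const_identity hΩ hu hdiv c hT] at h1
  simp only [pd2_scale (phi0_contDiff d), ← Finset.mul_sum, lap_phi0] at h1
  have e1 : ∀ y, ∑ i, ∑ j, (u y i - c i) * (u y j - c j) *
      (s⁻¹^2 * pd2 (phi0 d) i j (s⁻¹ • (y - x))) = s⁻¹^2 *
      ∑ i, ∑ j, (u y i - c i) * (u y j - c j) * pd2 (phi0 d) i j (s⁻¹ • (y - x)) := by
    intro y
    simp only [Finset.mul_sum]
    refine Finset.sum_congr rfl fun i _ => Finset.sum_congr rfl fun j _ => ?_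
    ring
  have hE : ∀ t, 0 < t → t ≤ s → IntegrableOn (fun y => p y * eta0 d (t⁻¹ • (y - x))) Ω := by
    intro t ht hts
    have hT2 := scaled_test (Ω := Ω) (eta0_contDiff d) (fun z => eta0_zero) ht
      ((Metric.closedBall_subset_closedBall hts).trans hx)
    exact integrableOn_mul_test hΩ hp hT2.1.continuous hT2.2.1 hT2.2.2
  have e2 : ∀ y, p y * (s⁻¹^2 * (eta0 d (s⁻¹ • (y - x)) - 2^d * eta0 d ((2:ℝ) • s⁻¹ • (y - x)))) =
      s⁻¹^2 * (p y * eta0 d (s⁻¹ • (y - x)) - 2^d * (p y * eta0 d ((s/2)⁻¹ • (y - x)))) := by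
    intro y
    rw [smul_smul, show (2:ℝ) * s⁻¹ = (s/2)⁻¹ by field_simp]
    ring
  simp only [e1, e2, integral_const_mul] at h1
  rw [integral_sub (hE s hs le_rfl) ((hE (s/2) (by linarith) (by linarith)).const_mul _),
    integral_const_mul, ← mul_neg] at h1
  have h2 := mul_left_cancel₀ (by positivity : s⁻¹^2 ≠ 0) h1
  unfold Qav Dav
  rw [← mul_neg, ← h2]
  rw [div_pow]
  field_simp

end Averages

section Limit
open Set Filter Topology

variable {d : ℕ}

lemma Qav_tendsto {Ω : Set (EuclideanSpace ℝ (Fin d))} (hΩ : IsOpen Ω)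
    {p : EuclideanSpace ℝ (Fin d) → ℝ} (hp : ContinuousOn p Ω)
    {x : EuclideanSpace ℝ (Fin d)} (hx : x ∈ Ω) :
    Tendsto (Qav Ω p x) (𝓝[>] 0) (𝓝 ((∫ z, eta0 d z) * p x)) := by
  obtain ⟨M, hM0, hM, -⟩ := (unit_test (eta0_contDiff d) (fun z => eta0_zero)).bounds
  set ω := volume.real (Metric.closedBall (0 : EuclideanSpace ℝ (Fin d)) 1) with hω
  have hω0 : 0 ≤ ω := measureReal_nonneg
  rw [Metric.tendsto_nhdsWithin_nhds]
  intro ε hε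
  set ε' := ε / (2 * (M * ω + 1)) with hε'
  have hε'0 : 0 < ε' := by positivity
  have hpc : ContinuousAt p x := hp.continuousAt (hΩ.mem_nhds hx)
  obtain ⟨δ1, hδ1, hb1⟩ := Metric.isOpen_iff.1 hΩ x hx
  obtain ⟨δ2, hδ2, hb2⟩ := Metric.continuousAt_iff.1 hpc ε' hε'0
  refine ⟨min δ1 δ2, lt_min hδ1 hδ2, ?_⟩
  intro s hs hs'
  have hs : 0 < s := hs
  rw [Real.dist_eq, sub_zero, abs_of_pos hs, lt_min_iff] at hs'
  have hball : Metric.closedBall x s ⊆ Ω :=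
    (Metric.closedBall_subset_ball hs'.1).trans hb1
  have hT := scaled_test (Ω := Ω) (eta0_contDiff d) (fun z => eta0_zero) hs hball
  have hzero : ∀ y ∉ Metric.closedBall x s, eta0 d (s⁻¹ • (y - x)) = 0 := by
    intro y hy
    apply eta0_zero
    rw [Metric.mem_closedBall, not_le, dist_eq_norm] at hy
    rw [norm_smul, norm_inv, Real.norm_of_nonneg hs.le, inv_mul_eq_div, one_le_div hs]
    exact hy.le
  have hc : (∫ z, eta0 d z) = (s^d)⁻¹ * ∫ y in Ω, eta0 d (s⁻¹ • (y - x)) := by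
    rw [setIntegral_eq_integral_of_forall_compl_eq_zero
      (fun y hy => hzero y (fun h => hy (hball h)))]
    rw [integral_sub_right_eq_self (fun y => eta0 d (s⁻¹ • y)) x,
      Measure.integral_comp_inv_smul]
    simp only [finrank_euclideanSpace, Fintype.card_fin, smul_eq_mul]
    rw [abs_of_pos (by positivity)]
    field_simp
  have hi1 : IntegrableOn (fun y => p y * eta0 d (s⁻¹ • (y - x))) Ω :=
    integrableOn_mul_test hΩ hp hT.1.continuous hT.2.1 hT.2.2
  have hi2 : IntegrableOn (fun y => p x * eta0 d (s⁻¹ • (y - x))) Ω :=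
    integrableOn_mul_test hΩ continuousOn_const hT.1.continuous hT.2.1 hT.2.2
  have hdiff : Qav Ω p x s - (∫ z, eta0 d z) * p x =
      (s^d)⁻¹ * ∫ y in Ω, (p y - p x) * eta0 d (s⁻¹ • (y - x)) := by
    simp only [sub_mul]
    rw [integral_sub hi1 hi2, integral_const_mul, hc, Qav]
    ring
  have hbd := setIntegral_ball_bound (f := fun y => (p y - p x) * eta0 d (s⁻¹ • (y - x)))
    (m := ε' * M) hs.le hball hΩ (by
      intro y hy
      rw [abs_mul]
      have h1 : |p y - p x| ≤ ε' := (hb2 (lt_of_le_of_lt (Metric.mem_closedBall.1 hy) hs'.2)).le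
      have := hM (s⁻¹ • (y - x))
      gcongr) (by
      intro y hy
      simp only [hzero y hy, mul_zero])
  rw [← hω] at hbd
  rw [Real.dist_eq, hdiff, abs_mul, abs_of_pos (by positivity : 0 < (s^d)⁻¹)]
  calc (s^d)⁻¹ * |∫ y in Ω, (p y - p x) * eta0 d (s⁻¹ • (y - x))|
      ≤ (s^d)⁻¹ * (ε' * M * (s^d * ω)) := by gcongr
    _ = ε' * (M * ω) := by field_simp
    _ < ε' * (2 * (M * ω + 1)) := by
        have : 0 ≤ M * ω := by positivity
        exact mul_lt_mul_of_pos_left (by linarith) hε'0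
    _ = ε := by rw [hε']; field_simp

end Limit

theorem interior_double_holder_regularity_of_pressure
    (d : ℕ) (hd : 3 ≤ d) (γ : ℝ) (hγ : γ ∈ Set.Ioo (0:ℝ) (1/2))
    (Ω : Set (EuclideanSpace ℝ (Fin d))) (hΩ : IsOpen Ω) (hΩne : Ω.Nonempty)
    (u : EuclideanSpace ℝ (Fin d) → EuclideanSpace ℝ (Fin d))
    (p : EuclideanSpace ℝ (Fin d) → ℝ)
    (hu : ContinuousOn u Ω)
    (Hu : ℝ)
    (hHolder : ∀ x ∈ Ω, ∀ y ∈ Ω, ‖u x - u y‖ ≤ Hu * ‖x - y‖ ^ γ)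
    (hdiv : ∀ φ : EuclideanSpace ℝ (Fin d) → ℝ, IsTestFun Ω φ →
      ∫ y in Ω, ⟪u y, gradient φ y⟫ = 0)
    (hp : ContinuousOn p Ω)
    (hploc : LocallyIntegrableOn p Ω)
    (hpress : ∀ φ : EuclideanSpace ℝ (Fin d) → ℝ, IsTestFun Ω φ →
      ∫ y in Ω, p y * (∑ i, pd2 φ i i y) =
        - ∫ y in Ω, (∑ i, ∑ j, u y i * u y j * pd2 φ i j y)) :
    ∀ K : Set (EuclideanSpace ℝ (Fin d)), IsCompact K → K ⊆ Ω →
      ∃ C > 0, ∀ x₁ ∈ K, ∀ x₂ ∈ K,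
        |p x₁ - p x₂| ≤ C * ‖x₁ - x₂‖ ^ (2 * γ) := by
  classical
  obtain ⟨hγ0, hγ1⟩ := hγ
  intro K hK hKΩ
  obtain ⟨δ, hδ, hδΩ⟩ := hK.exists_cthickening_subset_open hΩ hKΩ
  have hK' : IsCompact (Metric.cthickening δ K) := hK.cthickening
  obtain ⟨Mp, hMp⟩ := hK'.exists_bound_of_continuousOn (hp.mono hδΩ)
  have hcb : ∀ x ∈ K, Metric.closedBall x δ ⊆ Metric.cthickening δ K := fun x hx =>
    Metric.closedBall_subset_cthickening hx δ
  have hMp' : ∀ x ∈ K, |p x| ≤ |Mp| := fun x hx =>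
    (hMp x (hcb x hx (Metric.mem_closedBall_self hδ.le))).trans (le_abs_self _)
  set H := |Hu| with hH
  have hH0 : 0 ≤ H := abs_nonneg _
  have hHol : ∀ x ∈ Ω, ∀ y ∈ Ω, ‖u x - u y‖ ≤ H * ‖x - y‖ ^ γ := fun x hx y hy =>
    (hHolder x hx y hy).trans (by gcongr; exact le_abs_self _)
  set R := δ / 2 with hR
  have hR0 : 0 < R := by positivity
  set ω := volume.real (Metric.closedBall (0 : EuclideanSpace ℝ (Fin d)) 1) with hω
  have hω0 : 0 ≤ ω := measureReal_nonneg
  obtain ⟨Me, hMe0, -, hMe⟩ := (unit_test (eta0_contDiff d) (fun z => eta0_zero)).bounds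
  have hφT := unit_test (phi0_contDiff d) (fun z => phi0_zero)
  choose Mf hMf0 hMf1 hMf2 using fun i j => (hφT.pd2_test i j).bounds
  set M := ∑ i, ∑ j, Mf i j with hM
  have hM0 : 0 ≤ M := Finset.sum_nonneg fun i _ => Finset.sum_nonneg fun j _ => hMf0 i j
  have hMle : ∀ i j, Mf i j ≤ M := fun i j =>
    (Finset.single_le_sum (f := fun j => Mf i j) (fun j _ => hMf0 i j) (Finset.mem_univ j)).trans
      (Finset.single_le_sum (f := fun i => ∑ j, Mf i j)
        (fun i _ => Finset.sum_nonneg fun j _ => hMf0 i j) (Finset.mem_univ i))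
  have hk0 : ∀ (x : EuclideanSpace ℝ (Fin d)) (s : ℝ), 0 < s → ∀ i j, ∀ y ∉ Metric.closedBall x s,
      pd2 (phi0 d) i j (s⁻¹ • (y - x)) = 0 := by
    intro x s hs i j y hy
    apply image_eq_zero_of_notMem_tsupport
    intro hh
    have := (hφT.pd2_test i j).2.2 hh
    rw [Metric.mem_closedBall, dist_zero_right, norm_smul, norm_inv, Real.norm_of_nonneg hs.le,
      inv_mul_eq_div, div_le_one hs] at this
    exact hy (by rwa [Metric.mem_closedBall, dist_eq_norm])
  have he0 : ∀ (x : EuclideanSpace ℝ (Fin d)) (s : ℝ), 0 < s → ∀ y ∉ Metric.closedBall x s,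
      eta0 d (s⁻¹ • (y - x)) = 0 := by
    intro x s hs y hy
    apply eta0_zero
    rw [Metric.mem_closedBall, not_le, dist_eq_norm] at hy
    rw [norm_smul, norm_inv, Real.norm_of_nonneg hs.le, inv_mul_eq_div, one_le_div hs]
    exact hy.le
  have hui : ∀ i, ContinuousOn (fun y => u y i) Ω := fun i =>
    (EuclideanSpace.proj (𝕜 := ℝ) i).continuous.comp_continuousOn hu
  set c0 := ∫ z, eta0 d z with hc0
  have hc0pos : 0 < c0 := eta0_integral_pos (by omega)
  set A := d^2 * (H^2 * M) * ω with hA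
  set B := d^2 * (H^2 * 2^(2*γ) * M) * (2^d * ω) with hB
  set L := |Mp| * (Me * R⁻¹) * (2^d * ω) with hL
  have hA0 : 0 ≤ A := by positivity
  have hB0 : 0 ≤ B := by positivity
  have hL0 : 0 ≤ L := by positivity
  have hballΩ : ∀ x ∈ K, ∀ s ≤ δ, Metric.closedBall x s ⊆ Ω := fun x hx s hs =>
    (Metric.closedBall_subset_closedBall hs).trans ((hcb x hx).trans hδΩ)
  -- single point, one scale
  have step1 : ∀ x ∈ K, ∀ s, 0 < s → s ≤ R →
      |Qav Ω p x s - Qav Ω p x (s/2)| ≤ A * s^(2*γ) := by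
    intro x hx s hs hsR
    rw [Qav_step hΩ hu hp hdiv hpress hs (hballΩ x hx s (by linarith)) (u x), abs_neg, abs_mul,
      abs_of_pos (by positivity : 0 < (s^d)⁻¹)]
    have hb := quad_bound (k := fun i j y => pd2 (phi0 d) i j (s⁻¹ • (y - x))) hΩ hγ0 hH0 hHol
      hs.le (hballΩ x hx s (by linarith)) hM0
      (fun i j y => (hMf1 i j _).trans (hMle i j)) (fun i j y hy => hk0 x s hs i j y hy)
    calc (s^d)⁻¹ * |Dav Ω u (u x) x s|
        ≤ (s^d)⁻¹ * ((d^2 * (H^2 * s^(2*γ) * M)) * (s^d * ω)) := by gcongr; exact hb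
      _ = A * s^(2*γ) := by rw [hA]; field_simp
  -- two points, one scale
  have step2 : ∀ x₁ ∈ K, ∀ x₂ ∈ K, ∀ s, 0 < s → ‖x₁ - x₂‖ ≤ s → s ≤ R →
      |(Qav Ω p x₁ s - Qav Ω p x₁ (s/2)) - (Qav Ω p x₂ s - Qav Ω p x₂ (s/2))|
        ≤ B * s^(2*γ-1) * ‖x₁ - x₂‖ := by
    intro x₁ hx₁ x₂ hx₂ s hs hrs hsR
    rw [Qav_step hΩ hu hp hdiv hpress hs (hballΩ x₁ hx₁ s (by linarith)) (u x₁),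
      Qav_step hΩ hu hp hdiv hpress hs (hballΩ x₂ hx₂ s (by linarith)) (u x₁)]
    have hI : ∀ x ∈ K, IntegrableOn (fun y => ∑ i, ∑ j, (u y i - u x₁ i) * (u y j - u x₁ j) *
        pd2 (phi0 d) i j (s⁻¹ • (y - x))) Ω := by
      intro x hx
      refine integrable_finsetSum _ fun i _ => integrable_finsetSum _ fun j _ => ?_
      have hcont := (hφT.pd2_test i j).1.continuous
      have hb : tsupport (fun y => pd2 (phi0 d) i j (s⁻¹ • (y - x))) ⊆ Metric.closedBall x s := by
        refine closure_minimal ?_ Metric.isClosed_closedBall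
        intro y hy
        by_contra hn
        exact hy (hk0 x s hs i j y hn)
      exact integrableOn_mul_test hΩ (((hui i).sub continuousOn_const).mul
        ((hui j).sub continuousOn_const)) (by fun_prop)
        ((isCompact_closedBall x s).of_isClosed_subset (isClosed_tsupport _) hb)
        (hb.trans (hballΩ x hx s (by linarith)))
    have e : -((s^d)⁻¹ * Dav Ω u (u x₁) x₁ s) - -((s^d)⁻¹ * Dav Ω u (u x₁) x₂ s) =
        -((s^d)⁻¹ * ∫ y in Ω, ∑ i, ∑ j, (u y i - u x₁ i) * (u y j - u x₁ j) *
          (pd2 (phi0 d) i j (s⁻¹ • (y - x₁)) - pd2 (phi0 d) i j (s⁻¹ • (y - x₂)))) := by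
      simp only [mul_sub, Finset.sum_sub_distrib]
      simp only [Dav]
      rw [integral_sub (by simpa only [mul_sub, IntegrableOn] using hI x₁ hx₁)
        (by simpa only [mul_sub, IntegrableOn] using hI x₂ hx₂)]
      simp only [mul_sub]
      ring
    have hsub : ∀ y, s⁻¹ • (y - x₁) - s⁻¹ • (y - x₂) = s⁻¹ • (x₂ - x₁) := fun y => by
      rw [← smul_sub]; congr 1; abel
    have hb := quad_bound (k := fun i j y => pd2 (phi0 d) i j (s⁻¹ • (y - x₁)) -
        pd2 (phi0 d) i j (s⁻¹ • (y - x₂))) (x := x₁) (ρ := 2 * s)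
      (m := M * (s⁻¹ * ‖x₁ - x₂‖)) hΩ hγ0 hH0 hHol
      (by positivity) (hballΩ x₁ hx₁ (2*s) (by linarith)) (by positivity)
      (fun i j y => by
        refine (hMf2 i j _ _).trans ?_
        rw [hsub, norm_smul, norm_inv, Real.norm_of_nonneg hs.le, norm_sub_rev x₂ x₁]
        gcongr
        exact hMle i j)
      (fun i j y hy => by
        have hy1 : y ∉ Metric.closedBall x₁ s := fun h =>
          hy (Metric.closedBall_subset_closedBall (by linarith) h)
        have hy2 : y ∉ Metric.closedBall x₂ s := fun h => hy (by
          rw [Metric.mem_closedBall] at h ⊢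
          have h1 := dist_triangle y x₂ x₁
          rw [dist_eq_norm x₂ x₁, norm_sub_rev] at h1
          linarith)
        rw [hk0 x₁ s hs i j y hy1, hk0 x₂ s hs i j y hy2, sub_zero])
    rw [e, abs_neg, abs_mul, abs_of_pos (by positivity : 0 < (s^d)⁻¹)]
    refine (mul_le_mul_of_nonneg_left hb (by positivity)).trans (le_of_eq ?_)
    rw [hB, Real.mul_rpow (by norm_num) hs.le, Real.rpow_sub_one hs.ne', mul_pow, ← hω]
    field_simp
  -- two points, top scale
  have step3 : ∀ x₁ ∈ K, ∀ x₂ ∈ K, ‖x₁ - x₂‖ ≤ R →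
      |Qav Ω p x₁ R - Qav Ω p x₂ R| ≤ L * ‖x₁ - x₂‖ := by
    intro x₁ hx₁ x₂ hx₂ hrR
    have hI : ∀ x ∈ K, IntegrableOn (fun y => p y * eta0 d (R⁻¹ • (y - x))) Ω := by
      intro x hx
      have hT2 := scaled_test (Ω := Ω) (eta0_contDiff d) (fun z => eta0_zero) hR0
        (hballΩ x hx R (by linarith))
      exact integrableOn_mul_test hΩ hp hT2.1.continuous hT2.2.1 hT2.2.2
    have e : Qav Ω p x₁ R - Qav Ω p x₂ R = (R^d)⁻¹ * ∫ y in Ω, p y *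
        (eta0 d (R⁻¹ • (y - x₁)) - eta0 d (R⁻¹ • (y - x₂))) := by
      simp only [mul_sub]
      rw [integral_sub (by simpa only [mul_sub, IntegrableOn] using hI x₁ hx₁)
        (by simpa only [mul_sub, IntegrableOn] using hI x₂ hx₂), mul_sub, Qav, Qav]
    have hsub : ∀ y, R⁻¹ • (y - x₁) - R⁻¹ • (y - x₂) = R⁻¹ • (x₂ - x₁) := fun y => by
      rw [← smul_sub]; congr 1; abel
    have hb := setIntegral_ball_bound (f := fun y => p y *
        (eta0 d (R⁻¹ • (y - x₁)) - eta0 d (R⁻¹ • (y - x₂)))) (x := x₁) (ρ := 2 * R)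
      (m := |Mp| * (Me * (R⁻¹ * ‖x₁ - x₂‖)))
      (by positivity) (hballΩ x₁ hx₁ (2*R) (by linarith)) hΩ
      (fun y hy => by
        have h1 : |p y| ≤ |Mp| := (hMp y (hcb x₁ hx₁
          (Metric.closedBall_subset_closedBall (by linarith) hy))).trans (le_abs_self _)
        have h2 := hMe (R⁻¹ • (y - x₁)) (R⁻¹ • (y - x₂))
        rw [hsub, norm_smul, norm_inv, Real.norm_of_nonneg hR0.le, norm_sub_rev x₂ x₁] at h2
        rw [abs_mul]
        gcongr)
      (fun y hy => by
        have hy1 : y ∉ Metric.closedBall x₁ R := fun h =>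
          hy (Metric.closedBall_subset_closedBall (by linarith) h)
        have hy2 : y ∉ Metric.closedBall x₂ R := fun h => hy (by
          rw [Metric.mem_closedBall] at h ⊢
          have h1 := dist_triangle y x₂ x₁
          rw [dist_eq_norm x₂ x₁, norm_sub_rev] at h1
          linarith)
        rw [he0 x₁ R hR0 y hy1, he0 x₂ R hR0 y hy2, sub_zero, mul_zero])
    rw [e, abs_mul, abs_of_pos (by positivity : 0 < (R^d)⁻¹)]
    refine (mul_le_mul_of_nonneg_left hb (by positivity)).trans (le_of_eq ?_)
    rw [hL, mul_pow, ← hω]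
    field_simp
  set C1 := 2 * (A / (1 - 2^(-(2*γ))) * 2^(2*γ)) + L * R^(1-2*γ) + B / (2^(1-2*γ) - 1) with hC1
  have hC1 : 0 ≤ C1 := by
    have h1 : 0 ≤ A / (1 - 2^(-(2*γ))) := div_nonneg hA0 (by
      linarith [Real.rpow_lt_one_of_one_lt_of_neg (x := 2) (z := -(2*γ)) (by norm_num) (by linarith)])
    have h2 : 0 ≤ B / (2^(1-2*γ) - 1) := div_nonneg hB0 (by
      linarith [Real.one_lt_rpow (x := 2) (z := 1-2*γ) (by norm_num) (by linarith)])
    positivity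
  refine ⟨C1 / c0 + 2 * |Mp| / R^(2*γ) + 1, by positivity, ?_⟩
  intro x₁ hx₁ x₂ hx₂
  rcases eq_or_ne x₁ x₂ with rfl | hne
  · simp only [sub_self, abs_zero]; positivity
  have hr0 : 0 < ‖x₁ - x₂‖ := norm_pos_iff.2 (sub_ne_zero.2 hne)
  have hrp : 0 < ‖x₁ - x₂‖^(2*γ) := by positivity
  have hT1 : 0 ≤ C1 / c0 * ‖x₁ - x₂‖^(2*γ) := by positivity
  have hT2 : 0 ≤ 2 * |Mp| / R^(2*γ) * ‖x₁ - x₂‖^(2*γ) := by positivity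
  rcases le_total ‖x₁ - x₂‖ R with hle | hle
  · have h := two_point_scales (a := 2*γ) (by linarith) (by linarith) hA0 hB0 hL0 hr0 hle
      (step1 x₁ hx₁) (step1 x₂ hx₂)
      (fun s hs hsR => step2 x₁ hx₁ x₂ hx₂ s (hr0.trans_le hs) hs hsR)
      (step3 x₁ hx₁ x₂ hx₂ hle)
      (Qav_tendsto hΩ hp (hKΩ hx₁)) (Qav_tendsto hΩ hp (hKΩ hx₂))
    rw [← hc0, ← mul_sub, abs_mul, abs_of_pos hc0pos] at h
    have h2 : |p x₁ - p x₂| ≤ C1 / c0 * ‖x₁ - x₂‖^(2*γ) := by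
      rw [div_mul_eq_mul_div, le_div_iff₀ hc0pos, mul_comm]; exact h
    linarith
  · have h1 : |p x₁ - p x₂| ≤ 2 * |Mp| := by
      have := abs_sub (p x₁) (p x₂)
      linarith [hMp' x₁ hx₁, hMp' x₂ hx₂]
    have h2 : R^(2*γ) ≤ ‖x₁ - x₂‖^(2*γ) := Real.rpow_le_rpow hR0.le hle (by linarith)
    have h3 : 2 * |Mp| ≤ 2 * |Mp| / R^(2*γ) * ‖x₁ - x₂‖^(2*γ) := by
      have hRp : 0 < R^(2*γ) := by positivity
      rw [div_mul_eq_mul_div, le_div_iff₀ hRp]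
      gcongr
    linarith
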